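/- arXiv:2603.16510 — 2 statements merged into one kernel-verified Lean document; each statement's English description precedes it below -/
import Mathlib

section
/- Let (m₁, m₂) be a feasible schedule over [0,T] from a two-robot configuration (a₁,a₂) to a two-robot configuration (b₁,b₂), with each mᵢ continuous on [0,T]. Then there exist T' ≤ T and a feasible schedule (m₁', m₂') over [0,T'] from (a₁,a₂) to (b₁,b₂), each mᵢ' continuous, such that for each of the four orderings O ∈ {F→, F←, F↑, F↓}, the set of times {t ∈ [0,T'] : (m₁'(t), m₂'(t)) ∈ O} is order-connected (it contains the whole interval between any two of its points); that is, the new schedule never exits and later re-enters an ordering, and its makespan is no larger than that of the original schedule. -/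
/-- The L1 norm of a point of the plane. -/
noncomputable def l1 (p : ℝ × ℝ) : ℝ := |p.1| + |p.2|

/-- Two unit-square robots centered at `p₁`, `p₂` are interior disjoint. -/
def Feasible2 (p₁ p₂ : ℝ × ℝ) : Prop := max |p₁.1 - p₂.1| |p₁.2 - p₂.2| ≥ 1

/-- `m` is 1-Lipschitz on `[0, T]` with respect to the L1 distance. -/
def Lip1On (m : ℝ → ℝ × ℝ) (T : ℝ) : Prop :=
  ∀ s ∈ Set.Icc (0:ℝ) T, ∀ t ∈ Set.Icc (0:ℝ) T, l1 (m s - m t) ≤ |s - t|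

/-- `(m₁, m₂)` is a feasible schedule from `(a₁,a₂)` to `(b₁,b₂)` over `[0,T]`. -/
def IsSchedule2 (m₁ m₂ : ℝ → ℝ × ℝ) (a₁ a₂ b₁ b₂ : ℝ × ℝ) (T : ℝ) : Prop :=
  0 ≤ T ∧ m₁ 0 = a₁ ∧ m₂ 0 = a₂ ∧ m₁ T = b₁ ∧ m₂ T = b₂ ∧
  Lip1On m₁ T ∧ Lip1On m₂ T ∧
  ∀ t ∈ Set.Icc (0:ℝ) T, Feasible2 (m₁ t) (m₂ t)

/-- Replace `m` on `[s,t]` by the linear interpolation between `m s` and `m t`. -/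
noncomputable def interp {E : Type*} [AddCommGroup E] [Module ℝ E] (m : ℝ → E) (s t : ℝ) : ℝ → E :=
  fun u => if s ≤ u ∧ u ≤ t then m s + ((u - s) / (t - s)) • (m t - m s) else m u

section
variable {E : Type*} [AddCommGroup E] [Module ℝ E]

lemma interp_in (m : ℝ → E) {s t u : ℝ} (h1 : s ≤ u) (h2 : u ≤ t) :
    interp m s t u = m s + ((u - s) / (t - s)) • (m t - m s) := by
  simp [interp, h1, h2]

lemma interp_left (m : ℝ → E) {s t u : ℝ} (h : u ≤ s) : interp m s t u = m u := by
  unfold interp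
  split_ifs with h1
  · obtain rfl : u = s := le_antisymm h h1.1
    simp
  · rfl

lemma interp_right (m : ℝ → E) {s t u : ℝ} (h : t ≤ u) : interp m s t u = m u := by
  unfold interp
  split_ifs with h1
  · obtain rfl : u = t := le_antisymm h1.2 h
    rcases eq_or_lt_of_le h1.1 with h3 | h3
    · subst h3; simp
    · rw [div_self (by linarith), one_smul]; abel
  · rfl

lemma interp_comp (φ : E →ₗ[ℝ] ℝ) (m₁ m₂ : ℝ → E) (s t u : ℝ) :
    φ (interp m₁ s t u - interp m₂ s t u) = interp (fun v => φ (m₁ v - m₂ v)) s t u := by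
  unfold interp
  split_ifs
  · simp only [map_sub, map_add, map_smul, smul_eq_mul]; ring
  · rfl
end

lemma l1_tri (p q r : ℝ × ℝ) : l1 (p - r) ≤ l1 (p - q) + l1 (q - r) := by
  simp only [l1, Prod.fst_sub, Prod.snd_sub]
  have := abs_sub_le p.1 q.1 r.1
  have := abs_sub_le p.2 q.2 r.2
  linarith

lemma l1_comm (p q : ℝ × ℝ) : l1 (p - q) = l1 (q - p) := by
  simp only [l1, Prod.fst_sub, Prod.snd_sub]
  rw [abs_sub_comm p.1, abs_sub_comm p.2]

lemma glue {m : ℝ → ℝ × ℝ} {a b c : ℝ}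
    (h1 : ∀ u v, a ≤ u → u ≤ v → v ≤ b → l1 (m u - m v) ≤ v - u)
    (h2 : ∀ u v, b ≤ u → u ≤ v → v ≤ c → l1 (m u - m v) ≤ v - u) :
    ∀ u v, a ≤ u → u ≤ v → v ≤ c → l1 (m u - m v) ≤ v - u := by
  intro u v hu huv hv
  rcases le_total v b with hb | hb
  · exact h1 u v hu huv hb
  rcases le_total b u with hb' | hb'
  · exact h2 u v hb' huv hv
  have := l1_tri (m u) (m b) (m v)
  have := h1 u b hu hb' le_rfl
  have := h2 b v le_rfl hb hv
  linarith

lemma lip_interp {m : ℝ → ℝ × ℝ} {T s t : ℝ} (hs : 0 ≤ s) (hst : s ≤ t) (ht : t ≤ T)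
    (h : Lip1On m T) : Lip1On (interp m s t) T := by
  have h0 : ∀ u v, 0 ≤ u → u ≤ v → v ≤ T → l1 (m u - m v) ≤ v - u := by
    intro u v hu huv hv
    have := h u ⟨hu, huv.trans hv⟩ v ⟨hu.trans huv, hv⟩
    rwa [abs_sub_comm, abs_of_nonneg (by linarith)] at this
  have key : ∀ u v, 0 ≤ u → u ≤ v → v ≤ T →
      l1 (interp m s t u - interp m s t v) ≤ v - u := by
    refine glue (b := s) ?_ (glue (b := t) ?_ ?_)
    · intro u v hu huv hv
      rw [interp_left m hv, interp_left m (huv.trans hv)]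
      exact h0 u v hu huv (by linarith)
    · intro u v hu huv hv
      rw [interp_in m hu (huv.trans hv), interp_in m (hu.trans huv) hv]
      rcases eq_or_lt_of_le hst with h3 | h3
      · subst h3; simp [l1]; linarith
      have e : m s + ((u - s) / (t - s)) • (m t - m s) -
          (m s + ((v - s) / (t - s)) • (m t - m s)) = ((v - u) / (t - s)) • (m s - m t) := by
        ext <;> simp <;> ring
      rw [e]
      have hn : 0 ≤ (v - u) / (t - s) := div_nonneg (by linarith) (by linarith)
      have : l1 (((v - u) / (t - s)) • (m s - m t)) = (v - u) / (t - s) * l1 (m s - m t) := by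
        simp only [l1, Prod.smul_fst, Prod.smul_snd, smul_eq_mul, abs_mul, abs_of_nonneg hn]
        ring
      rw [this]
      calc _ ≤ (v - u) / (t - s) * (t - s) :=
            mul_le_mul_of_nonneg_left (h0 s t hs hst ht) hn
        _ = v - u := div_mul_cancel₀ _ (by linarith)
    · intro u v hu huv hv
      rw [interp_right m hu, interp_right m (hu.trans huv)]
      exact h0 u v (by linarith) huv hv
  intro u hu v hv
  rcases le_total u v with huv | huv
  · rw [abs_sub_comm, abs_of_nonneg (by linarith)]
    exact key u v hu.1 huv hv.2
  · rw [l1_comm, abs_of_nonneg (by linarith)]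
    exact key v u hv.1 huv hu.2

lemma lip_cont {m : ℝ → ℝ × ℝ} {T : ℝ} (h : Lip1On m T) : ContinuousOn m (Set.Icc 0 T) := by
  have : LipschitzOnWith 1 m (Set.Icc 0 T) := by
    refine LipschitzOnWith.of_dist_le_mul fun x hx y hy => ?_
    have := h x hx y hy
    simp only [l1, Prod.fst_sub, Prod.snd_sub] at this
    rw [Prod.dist_eq, Real.dist_eq, Real.dist_eq, Real.dist_eq]
    have := abs_nonneg ((m x).1 - (m y).1)
    have := abs_nonneg ((m x).2 - (m y).2)
    simp only [NNReal.coe_one, one_mul]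
    exact max_le (by linarith) (by linarith)
  exact this.continuousOn

lemma interp_min (f : ℝ → ℝ) {s t x y z : ℝ} (h1 : s ≤ x) (h2 : x ≤ y) (h3 : y ≤ z) (h4 : z ≤ t)
    (hx : 1 ≤ interp f s t x) (hz : 1 ≤ interp f s t z) : 1 ≤ interp f s t y := by
  rw [interp_in f h1 (by linarith)] at hx
  rw [interp_in f (by linarith) h4] at hz
  rw [interp_in f (by linarith) (by linarith)]
  simp only [smul_eq_mul] at *
  have hst : 0 ≤ t - s := by linarith
  have a : (x - s) / (t - s) ≤ (y - s) / (t - s) := by gcongr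
  have b : (y - s) / (t - s) ≤ (z - s) / (t - s) := by gcongr
  rcases le_total 0 (f t - f s) with h | h
  · have := mul_le_mul_of_nonneg_right a h
    linarith
  · have := mul_le_mul_of_nonpos_right b h
    linarith

lemma interp_max (f : ℝ → ℝ) {s t y : ℝ} (h1 : s ≤ y) (h2 : y ≤ t)
    (hy : 1 ≤ interp f s t y) : 1 ≤ f s ∨ 1 ≤ f t := by
  rw [interp_in f h1 h2] at hy
  simp only [smul_eq_mul] at *
  have hst : 0 ≤ t - s := by linarith
  have a : 0 ≤ (y - s) / (t - s) := div_nonneg (by linarith) hst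
  have b : (y - s) / (t - s) ≤ 1 := div_le_one_of_le₀ (by linarith) hst
  rcases le_total 0 (f t - f s) with h | h
  · right; nlinarith
  · left; nlinarith

lemma conn_interp {f : ℝ → ℝ} {T s t : ℝ} (hs : 0 ≤ s) (hst : s ≤ t) (ht : t ≤ T)
    (h : ({u ∈ Set.Icc (0:ℝ) T | 1 ≤ f u}).OrdConnected) :
    ({u ∈ Set.Icc (0:ℝ) T | 1 ≤ interp f s t u}).OrdConnected := by
  have H : ∀ x y z, 0 ≤ x → x ≤ y → y ≤ z → z ≤ T → 1 ≤ f x → 1 ≤ f z → 1 ≤ f y := by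
    intro x y z h1 h2 h3 h4 hx hz
    exact (h.out (x := x) (y := z) ⟨⟨h1, by linarith⟩, hx⟩ ⟨⟨by linarith, h4⟩, hz⟩ ⟨h2, h3⟩).2
  refine ⟨?_⟩
  rintro x ⟨⟨hx0, hxT⟩, hx⟩ z ⟨⟨hz0, hzT⟩, hz⟩ y ⟨hxy, hyz⟩
  refine ⟨⟨by linarith, by linarith⟩, ?_⟩
  rcases le_total y s with hys | hys
  · rw [interp_left f hys]
    rw [interp_left f (hxy.trans hys)] at hx
    rcases le_total z s with hzs | hzs
    · rw [interp_left f hzs] at hz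
      exact H x y z hx0 hxy hyz hzT hx hz
    rcases le_total t z with hzt | hzt
    · rw [interp_right f hzt] at hz
      exact H x y z hx0 hxy hyz hzT hx hz
    rcases interp_max f hzs hzt hz with h' | h'
    · exact H x y s hx0 hxy hys (by linarith) hx h'
    · exact H x y t hx0 hxy (by linarith) (by linarith) hx h'
  rcases le_total t y with hyt | hyt
  · rw [interp_right f hyt]
    rw [interp_right f (hyt.trans hyz)] at hz
    rcases le_total x s with hxs | hxs
    · rw [interp_left f hxs] at hx
      exact H x y z hx0 hxy hyz hzT hx hz
    rcases le_total t x with hxt | hxt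
    · rw [interp_right f hxt] at hx
      exact H x y z hx0 hxy hyz hzT hx hz
    rcases interp_max f hxs hxt hx with h' | h'
    · exact H s y z hs (by linarith) hyz hzT h' hz
    · exact H t y z (by linarith) hyt hyz hzT h' hz
  have es : interp f s t s = f s := interp_left f le_rfl
  have et : interp f s t t = f t := interp_right f le_rfl
  rcases le_total s x with hsx | hsx <;> rcases le_total z t with hzt | hzt
  · exact interp_min f hsx hxy hyz hzt hx hz
  · rw [interp_right f hzt] at hz
    refine interp_min f hsx hxy hyt le_rfl hx ?_
    rw [et]
    rcases interp_max f hsx (by linarith) hx with h' | h'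
    · exact H s t z hs hst hzt hzT h' hz
    · exact h'
  · rw [interp_left f hsx] at hx
    refine interp_min f le_rfl hys hyz hzt ?_ hz
    rw [es]
    rcases interp_max f (by linarith) hzt hz with h' | h'
    · exact h'
    · exact H x s t hx0 hsx hst ht hx h'
  · rw [interp_left f hsx] at hx
    rw [interp_right f hzt] at hz
    refine interp_min f le_rfl hys hyt le_rfl ?_ ?_
    · rw [es]; exact H x s z hx0 hsx (by linarith) hzT hx hz
    · rw [et]; exact H x t z hx0 (by linarith) hzt hzT hx hz

/-- The set of times at which the functional `φ` of the relative position is at least one. -/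
def OrdSet (φ : ℝ × ℝ →L[ℝ] ℝ) (m₁ m₂ : ℝ → ℝ × ℝ) (T : ℝ) : Set ℝ :=
  {u ∈ Set.Icc (0:ℝ) T | 1 ≤ φ (m₁ u - m₂ u)}

lemma step (φ : ℝ × ℝ →L[ℝ] ℝ) (hφ : ∀ p q, 1 ≤ φ (p - q) → Feasible2 p q)
    {a₁ a₂ b₁ b₂ : ℝ × ℝ} {T : ℝ} {m₁ m₂ : ℝ → ℝ × ℝ}
    (hsch : IsSchedule2 m₁ m₂ a₁ a₂ b₁ b₂ T) :
    ∃ m₁' m₂' : ℝ → ℝ × ℝ, IsSchedule2 m₁' m₂' a₁ a₂ b₁ b₂ T ∧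
      (OrdSet φ m₁' m₂' T).OrdConnected ∧
      ∀ ψ : ℝ × ℝ →L[ℝ] ℝ, (OrdSet ψ m₁ m₂ T).OrdConnected →
        (OrdSet ψ m₁' m₂' T).OrdConnected := by
  obtain ⟨hT, e1, e2, e3, e4, l₁, l₂, hf⟩ := hsch
  rcases (OrdSet φ m₁ m₂ T).eq_empty_or_nonempty with hE | hE
  · refine ⟨m₁, m₂, ⟨hT, e1, e2, e3, e4, l₁, l₂, hf⟩, ?_, fun _ h => h⟩
    rw [hE]; exact Set.ordConnected_empty
  have hcont : ContinuousOn (fun u => φ (m₁ u - m₂ u)) (Set.Icc 0 T) :=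
    φ.continuous.comp_continuousOn ((lip_cont l₁).sub (lip_cont l₂))
  have hcl : IsClosed (OrdSet φ m₁ m₂ T) :=
    hcont.preimage_isClosed_of_isClosed isClosed_Icc isClosed_Ici
  have hcomp : IsCompact (OrdSet φ m₁ m₂ T) :=
    isCompact_Icc.of_isClosed_subset hcl (fun _ h => h.1)
  obtain ⟨s, hs, hsmin⟩ := hcomp.exists_isLeast hE
  obtain ⟨t, ht, htmax⟩ := hcomp.exists_isGreatest hE
  have hst : s ≤ t := hsmin ht
  have hs0 : 0 ≤ s := hs.1.1
  have htT : t ≤ T := ht.1.2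
  have comp : ∀ (ψ : ℝ × ℝ →L[ℝ] ℝ) u, ψ (interp m₁ s t u - interp m₂ s t u) =
      interp (fun v => ψ (m₁ v - m₂ v)) s t u := fun ψ u =>
    interp_comp ψ.toLinearMap m₁ m₂ s t u
  have inside : ∀ u, s ≤ u → u ≤ t → 1 ≤ φ (interp m₁ s t u - interp m₂ s t u) := by
    intro u h1 h2
    rw [comp]
    refine interp_min _ le_rfl h1 h2 le_rfl ?_ ?_
    · rw [interp_left _ le_rfl]; exact hs.2
    · rw [interp_right _ le_rfl]; exact ht.2
  refine ⟨interp m₁ s t, interp m₂ s t, ⟨hT, ?_, ?_, ?_, ?_, lip_interp hs0 hst htT l₁,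
    lip_interp hs0 hst htT l₂, ?_⟩, ?_, ?_⟩
  · rw [interp_left _ hs0, e1]
  · rw [interp_left _ hs0, e2]
  · rw [interp_right _ htT, e3]
  · rw [interp_right _ htT, e4]
  · intro u hu
    rcases le_total u s with h1 | h1
    · rw [interp_left _ h1, interp_left _ h1]; exact hf u hu
    rcases le_total t u with h2 | h2
    · rw [interp_right _ h2, interp_right _ h2]; exact hf u hu
    exact hφ _ _ (inside u h1 h2)
  · refine ⟨?_⟩
    rintro x ⟨hx0, hx⟩ z ⟨hz0, hz⟩ y ⟨hxy, hyz⟩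
    refine ⟨⟨hx0.1.trans hxy, hyz.trans hz0.2⟩, inside y ?_ ?_⟩
    · rcases le_total s x with h | h
      · exact h.trans hxy
      · rw [interp_left _ h, interp_left _ h] at hx
        exact (hsmin ⟨hx0, hx⟩).trans hxy
    · rcases le_total z t with h | h
      · exact hyz.trans h
      · rw [interp_right _ h, interp_right _ h] at hz
        exact hyz.trans (htmax ⟨hz0, hz⟩)
  · intro ψ h
    unfold OrdSet
    simp only [comp]
    exact conn_interp hs0 hst htT h

theorem stmt6 (a₁ a₂ b₁ b₂ : ℝ × ℝ) (T : ℝ) (m₁ m₂ : ℝ → ℝ × ℝ)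
    (hsch : IsSchedule2 m₁ m₂ a₁ a₂ b₁ b₂ T)
    (hc₁ : ContinuousOn m₁ (Set.Icc 0 T)) (hc₂ : ContinuousOn m₂ (Set.Icc 0 T)) :
    ∃ T' ≤ T, ∃ m₁' m₂' : ℝ → ℝ × ℝ,
      IsSchedule2 m₁' m₂' a₁ a₂ b₁ b₂ T' ∧
      ContinuousOn m₁' (Set.Icc 0 T') ∧ ContinuousOn m₂' (Set.Icc 0 T') ∧
      ({t ∈ Set.Icc (0:ℝ) T' | (m₁' t).1 ≥ (m₂' t).1 + 1}).OrdConnected ∧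
      ({t ∈ Set.Icc (0:ℝ) T' | (m₂' t).1 ≥ (m₁' t).1 + 1}).OrdConnected ∧
      ({t ∈ Set.Icc (0:ℝ) T' | (m₁' t).2 ≥ (m₂' t).2 + 1}).OrdConnected ∧
      ({t ∈ Set.Icc (0:ℝ) T' | (m₂' t).2 ≥ (m₁' t).2 + 1}).OrdConnected := by
  obtain ⟨p₁, p₂, hp, c1, -⟩ := step (ContinuousLinearMap.fst ℝ ℝ ℝ) (by
    intro p q h
    exact le_max_of_le_left (le_trans h (le_abs_self (p.1 - q.1)))) hsch
  obtain ⟨q₁, q₂, hq, c2, k2⟩ := step (-ContinuousLinearMap.fst ℝ ℝ ℝ) (by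
    intro p q h
    exact le_max_of_le_left (le_trans h (neg_le_abs (p.1 - q.1)))) hp
  obtain ⟨r₁, r₂, hr, c3, k3⟩ := step (ContinuousLinearMap.snd ℝ ℝ ℝ) (by
    intro p q h
    exact le_max_of_le_right (le_trans h (le_abs_self (p.2 - q.2)))) hq
  obtain ⟨w₁, w₂, hw, c4, k4⟩ := step (-ContinuousLinearMap.snd ℝ ℝ ℝ) (by
    intro p q h
    exact le_max_of_le_right (le_trans h (neg_le_abs (p.2 - q.2)))) hr
  refine ⟨T, le_rfl, w₁, w₂, hw, lip_cont hw.2.2.2.2.2.1, lip_cont hw.2.2.2.2.2.2.1, ?_, ?_, ?_, ?_⟩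
  · convert k4 _ (k3 _ (k2 _ c1)) using 1
    ext u
    simp [OrdSet, le_sub_iff_add_le, add_comm]
  · convert k4 _ (k3 _ c2) using 1
    ext u
    simp [OrdSet, le_sub_iff_add_le, add_comm]
  · convert k4 _ c3 using 1
    ext u
    simp [OrdSet, le_sub_iff_add_le, add_comm]
  · convert c4 using 1
    ext u
    simp [OrdSet, le_sub_iff_add_le, add_comm]
end

section
/- Let (m₁, m₂) be a feasible schedule over [0,T] from (a₁,a₂) to (b₁,b₂) with each mᵢ continuous on [0,T], such that (a₁,a₂) ∈ F↑ (y(a₁) ≥ y(a₂)+1), (b₁,b₂) ∈ F→ (x(b₁) ≥ x(b₂)+1), and for every t ∈ [0,T] the configuration (m₁(t), m₂(t)) lies in F↑ ∪ F→. Then there exists t* ∈ [0,T] such that the configuration I = (i₁, i₂) = (m₁(t*), m₂(t*)) is diagonal (x(i₁) ≥ x(i₂)+1 and y(i₁) ≥ y(i₂)+1), and the total traveled length of the schedule, i.e. the sum over i of the L1 length of mᵢ over [0,T], is at least (‖a₁ − i₁‖₁ + ‖i₁ − b₁‖₁) + (‖a₂ − i₂‖₁ + ‖i₂ − b₂‖₁).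 -/
/-- The L1 length of a trajectory over `[0,T]`: its total variation on `[0,T]`
with respect to the L1 distance on the plane. -/
noncomputable def l1Length (m : ℝ → ℝ × ℝ) (T : ℝ) : ENNReal :=
  eVariationOn (fun t => (WithLp.equiv 1 (ℝ × ℝ)).symm (m t)) (Set.Icc 0 T)

theorem l1_dist_aux (p q : ℝ × ℝ) :
    edist ((WithLp.equiv 1 (ℝ × ℝ)).symm p) ((WithLp.equiv 1 (ℝ × ℝ)).symm q)
      = ENNReal.ofReal (l1 (p - q)) := by
  rw [edist_dist, WithLp.prod_dist_eq_of_L1]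
  simp [l1, Real.dist_eq]

theorem l1_length_aux (m : ℝ → ℝ × ℝ) (T t : ℝ) (ht : t ∈ Set.Icc (0:ℝ) T) :
    ENNReal.ofReal (l1 (m 0 - m t) + l1 (m t - m T)) ≤ l1Length m T := by
  have h0 : ∀ p, 0 ≤ l1 p := fun p => by unfold l1; positivity
  rw [ENNReal.ofReal_add (h0 _) (h0 _), ← l1_dist_aux, ← l1_dist_aux]
  unfold l1Length
  have h := eVariationOn.Icc_add_Icc (fun t => (WithLp.equiv 1 (ℝ × ℝ)).symm (m t))
    (s := Set.univ) ht.1 ht.2 (Set.mem_univ _)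
  simp only [Set.univ_inter] at h
  rw [← h]
  exact add_le_add
    (eVariationOn.edist_le (fun t => (WithLp.equiv 1 (ℝ × ℝ)).symm (m t))
      (Set.left_mem_Icc.2 ht.1) (Set.right_mem_Icc.2 ht.1))
    (eVariationOn.edist_le (fun t => (WithLp.equiv 1 (ℝ × ℝ)).symm (m t))
      (Set.left_mem_Icc.2 ht.2) (Set.right_mem_Icc.2 ht.2))

theorem stmt11 (a₁ a₂ b₁ b₂ : ℝ × ℝ) (T : ℝ) (m₁ m₂ : ℝ → ℝ × ℝ)
    (hsch : IsSchedule2 m₁ m₂ a₁ a₂ b₁ b₂ T)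
    (hc₁ : ContinuousOn m₁ (Set.Icc 0 T)) (hc₂ : ContinuousOn m₂ (Set.Icc 0 T))
    (hstart : a₁.2 ≥ a₂.2 + 1) (hend : b₁.1 ≥ b₂.1 + 1)
    (hall : ∀ t ∈ Set.Icc (0:ℝ) T,
      (m₁ t).1 ≥ (m₂ t).1 + 1 ∨ (m₁ t).2 ≥ (m₂ t).2 + 1) :
    ∃ t ∈ Set.Icc (0:ℝ) T,
      (m₁ t).1 ≥ (m₂ t).1 + 1 ∧ (m₁ t).2 ≥ (m₂ t).2 + 1 ∧
      ENNReal.ofReal ((l1 (a₁ - m₁ t) + l1 (m₁ t - b₁)) +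
          (l1 (a₂ - m₂ t) + l1 (m₂ t - b₂))) ≤
        l1Length m₁ T + l1Length m₂ T := by
  obtain ⟨hT, rfl, rfl, rfl, rfl, -, -, -⟩ := hsch
  have key : ∃ t ∈ Set.Icc (0:ℝ) T,
      (m₁ t).1 ≥ (m₂ t).1 + 1 ∧ (m₁ t).2 ≥ (m₂ t).2 + 1 := by
    by_cases h0 : (m₁ 0).1 ≥ (m₂ 0).1 + 1
    · exact ⟨0, Set.left_mem_Icc.2 hT, h0, hstart⟩
    by_cases h1 : (m₁ T).2 ≥ (m₂ T).2 + 1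
    · exact ⟨T, Set.right_mem_Icc.2 hT, hend, h1⟩
    push Not at h0 h1
    have hc : ContinuousOn
        (fun t => ((m₁ t).1 - (m₂ t).1) - ((m₁ t).2 - (m₂ t).2)) (Set.Icc 0 T) :=
      (hc₁.fst.sub hc₂.fst).sub (hc₁.snd.sub hc₂.snd)
    obtain ⟨t, ht, h⟩ := intermediate_value_Icc hT hc
      (show (0:ℝ) ∈ Set.Icc _ _ from ⟨by linarith, by linarith⟩)
    simp only at h
    refine ⟨t, ht, ?_⟩
    rcases hall t ht with h2 | h2 <;> constructor <;> linarith
  obtain ⟨t, ht, hx, hy⟩ := key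
  refine ⟨t, ht, hx, hy, ?_⟩
  have h0 : ∀ p, 0 ≤ l1 p := fun p => by unfold l1; positivity
  rw [ENNReal.ofReal_add (add_nonneg (h0 _) (h0 _)) (add_nonneg (h0 _) (h0 _))]
  exact add_le_add (l1_length_aux m₁ T t ht) (l1_length_aux m₂ T t ht)
end
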